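/- Let (S, wt) be a decomposable full passport with N = |S|, and let w̃t = wt + ε be a perturbed weight constructed from E_0, ε_0, s_− and ε as in the perturbed-passport construction. Then every permutation of S whose w̃t-cumulative sums H̃_i are positive for all 1 ≤ i ≤ N−1 has wt-cumulative sums H_i ≥ 0 for all 1 ≤ i ≤ N−1; i.e., P_+(S, w̃t) ⊆ P_{≥0}(S, wt). -/

import Mathlib

open Finset

/-- Cumulative sums of a permutation of a weighted finite set:
`cumSum w P i = H_i = w s_1 + ⋯ + w s_i`, where `s_j = P (j-1)` (0-indexed). -/
noncomputable def cumSum {α : Type*} [Fintype α] (w : α → ℝ)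
    (P : Fin (Fintype.card α) ≃ α) (i : ℕ) : ℝ :=
  ∑ j ∈ Finset.univ.filter (fun j : Fin (Fintype.card α) => (j : ℕ) < i), w (P j)

theorem sum_le_of_le_div_card_sub_one {α : Type*} [Fintype α] [DecidableEq α]
    (hcard : 2 ≤ Fintype.card α) {E : ℝ} {a : α} {f : α → ℝ}
    (hf : ∀ s, s ≠ a → 0 ≤ f s ∧ f s ≤ E / (Fintype.card α - 1)) (ha : f a ≤ 0)
    (A : Finset α) : ∑ s ∈ A, f s ≤ E := by
  have hpos : (0 : ℝ) < Fintype.card α - 1 := by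
    have : (2 : ℝ) ≤ Fintype.card α := by exact_mod_cast hcard
    linarith
  have herase : ∑ s ∈ A, f s ≤ ∑ s ∈ A.erase a, f s := by
    by_cases h : a ∈ A
    · rw [← Finset.add_sum_erase A f h]
      linarith
    · rw [Finset.erase_eq_of_notMem h]
  calc ∑ s ∈ A, f s ≤ ∑ s ∈ A.erase a, f s := herase
    _ ≤ ∑ s ∈ Finset.univ.erase a, f s :=
        Finset.sum_le_sum_of_subset_of_nonneg (Finset.erase_subset_erase a (Finset.subset_univ A))
          fun s hs _ => (hf s (Finset.ne_of_mem_erase hs)).1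
    _ ≤ ∑ _s ∈ Finset.univ.erase a, E / (Fintype.card α - 1) :=
        Finset.sum_le_sum fun s hs => (hf s (Finset.ne_of_mem_erase hs)).2
    _ = E := by
        rw [Finset.sum_const, Finset.card_erase_of_mem (Finset.mem_univ a), Finset.card_univ,
          nsmul_eq_mul, Nat.cast_sub (by omega), Nat.cast_one, mul_div_cancel₀ _ hpos.ne']

theorem cumSum_eq_sum_map {α : Type*} [Fintype α] (w : α → ℝ)
    (P : Fin (Fintype.card α) ≃ α) (i : ℕ) :
    cumSum w P i = ∑ s ∈ (Finset.univ.filter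
      (fun j : Fin (Fintype.card α) => (j : ℕ) < i)).map P.toEmbedding, w s := by
  simp [cumSum]

theorem stmt_11 {α : Type*} [Fintype α] [DecidableEq α] (wt : α → ℝ)
    (hwt : ∀ s, wt s ≠ 0) (hsum : ∑ s, wt s = 0) (hcard : 2 ≤ Fintype.card α)
    (hdec : ∃ A : Finset α, A.Nonempty ∧ A ≠ Finset.univ ∧ ∑ s ∈ A, wt s = 0)
    (E₀ : ℝ)
    (hE0min : ∀ A : Finset α, (∑ s ∈ A, wt s) ≠ 0 → E₀ ≤ |(∑ s ∈ A, wt s)|)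
    (hE0mem : ∃ A : Finset α, (∑ s ∈ A, wt s) ≠ 0 ∧ |(∑ s ∈ A, wt s)| = E₀)
    (sneg : α) (ε : α → ℝ)
    (hε : ∀ s, s ≠ sneg → 0 < ε s ∧ ε s < E₀ / (Fintype.card α - 1))
    (hεneg : ε sneg = -∑ s ∈ Finset.univ.erase sneg, ε s) :
    ∀ P : Fin (Fintype.card α) ≃ α,
      (∀ i, 1 ≤ i → i ≤ Fintype.card α - 1 → 0 < cumSum (fun s => wt s + ε s) P i) →
      ∀ i, 1 ≤ i → i ≤ Fintype.card α - 1 → 0 ≤ cumSum wt P i := by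
  intro P hP i hi hi'
  by_contra! hneg
  have hpert := hP i hi hi'
  rw [cumSum_eq_sum_map] at hneg hpert
  rw [Finset.sum_add_distrib] at hpert
  have hmin := hE0min _ hneg.ne
  rw [abs_of_neg hneg] at hmin
  have hεle : ε sneg ≤ 0 := by
    rw [hεneg, neg_nonpos]
    exact Finset.sum_nonneg fun s hs => (hε s (Finset.ne_of_mem_erase hs)).1.le
  have hεsum := sum_le_of_le_div_card_sub_one hcard
    (fun s hs => ⟨(hε s hs).1.le, (hε s hs).2.le⟩) hεle
    ((Finset.univ.filter (fun j : Fin (Fintype.card α) => (j : ℕ) < i)).map P.toEmbedding)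
  linarith
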